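/- arXiv:2312.00838 — 3 statements merged into one kernel-verified Lean document; each statement's English description precedes it below -/
import Mathlib

section
/- The function x ↦ x/((x − i)^3 (x + i)^2) is integrable on ℝ and ∫_{-∞}^{+∞} x/((x − i)^3 (x + i)^2) dx = π/8. -/
open Complex MeasureTheory Real

open Filter Topology

lemma div_sub_I_cube_mul_add_I_sq (x : ℝ) :
    (x : ℂ) / (((x : ℂ) - I) ^ 3 * ((x : ℂ) + I) ^ 2) =
      ((x ^ 2 / (1 + x ^ 2) ^ 3 : ℝ) : ℂ) + ((x / (1 + x ^ 2) ^ 3 : ℝ) : ℂ) * I := by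
  have hfac : (1 + (x : ℂ) ^ 2) = ((x : ℂ) - I) * ((x : ℂ) + I) := by
    linear_combination I_sq
  have hne : (1 + (x : ℂ) ^ 2) ≠ 0 := by
    exact_mod_cast (by positivity : (1 + x ^ 2 : ℝ) ≠ 0)
  push_cast
  rw [hfac] at hne ⊢
  have hsub := left_ne_zero_of_mul hne
  have hadd := right_ne_zero_of_mul hne
  field_simp

lemma integrable_of_abs_le_inv_one_add_sq {f : ℝ → ℝ} (hf : Continuous f)
    (hle : ∀ x, |f x| ≤ (1 + x ^ 2)⁻¹) : Integrable f :=
  integrable_inv_one_add_sq.mono' hf.aestronglyMeasurable (.of_forall hle)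

lemma integrable_sq_div_one_add_sq_cube :
    Integrable fun x : ℝ => x ^ 2 / (1 + x ^ 2) ^ 3 := by
  refine integrable_of_abs_le_inv_one_add_sq
    (Continuous.div (by fun_prop) (by fun_prop) fun x => by positivity) fun x => ?_
  rw [abs_of_nonneg (by positivity), inv_eq_one_div, div_le_div_iff₀ (by positivity) (by positivity)]
  nlinarith [sq_nonneg x, sq_nonneg (x ^ 2), sq_nonneg (x ^ 3)]

lemma integrable_div_one_add_sq_cube :
    Integrable fun x : ℝ => x / (1 + x ^ 2) ^ 3 := by
  refine integrable_of_abs_le_inv_one_add_sq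
    (Continuous.div (by fun_prop) (by fun_prop) fun x => by positivity) fun x => ?_
  have hx : |x| ≤ (1 + x ^ 2) ^ 2 := by
    rw [← sq_abs x]
    nlinarith [sq_nonneg (|x| - 1), sq_nonneg (|x| ^ 2)]
  rw [abs_div, abs_of_pos (by positivity : 0 < (1 + x ^ 2) ^ 3), inv_eq_one_div,
    div_le_div_iff₀ (by positivity) (by positivity)]
  nlinarith [mul_le_mul_of_nonneg_right hx (by positivity : 0 ≤ 1 + x ^ 2)]

lemma integral_div_one_add_sq_cube : ∫ x : ℝ, x / (1 + x ^ 2) ^ 3 = 0 := by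
  have h := integral_neg_eq_self (fun x : ℝ => x / (1 + x ^ 2) ^ 3) volume
  simp only [neg_sq, neg_div, integral_neg] at h
  linarith

lemma tendsto_cube_sub_self_div_cocompact :
    Tendsto (fun x : ℝ => (x ^ 3 - x) / (8 * (1 + x ^ 2) ^ 2)) (cocompact ℝ) (𝓝 0) := by
  refine squeeze_zero_norm (a := fun x : ℝ => ‖x‖⁻¹) (fun x => ?_)
    (tendsto_inv_atTop_zero.comp (tendsto_norm_cocompact_atTop (E := ℝ)))
  rcases eq_or_ne x 0 with rfl | hx
  · simp
  have hpos := abs_pos.mpr hx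
  rw [Real.norm_eq_abs, Real.norm_eq_abs, abs_div,
    abs_of_pos (by positivity : 0 < 8 * (1 + x ^ 2) ^ 2), inv_eq_one_div,
    div_le_div_iff₀ (by positivity) hpos, ← abs_mul]
  refine (abs_le.mpr ⟨?_, ?_⟩).trans_eq (one_mul _).symm <;>
    nlinarith [sq_nonneg x, sq_nonneg (x ^ 2)]

lemma integral_sq_div_one_add_sq_cube : ∫ x : ℝ, x ^ 2 / (1 + x ^ 2) ^ 3 = π / 8 := by
  have hderiv (x : ℝ) : HasDerivAt
      (fun x : ℝ => Real.arctan x / 8 + (x ^ 3 - x) / (8 * (1 + x ^ 2) ^ 2))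
      (x ^ 2 / (1 + x ^ 2) ^ 3) x := by
    have hnum : HasDerivAt (fun x : ℝ => x ^ 3 - x) (3 * x ^ 2 - 1) x := by
      simpa using (hasDerivAt_pow 3 x).fun_sub (hasDerivAt_id' x)
    have hden : HasDerivAt (fun x : ℝ => 8 * (1 + x ^ 2) ^ 2)
        (8 * (2 * (1 + x ^ 2) * (2 * x))) x := by
      simpa using (((hasDerivAt_pow 2 x).const_add 1).fun_pow 2).const_mul 8
    refine (((Real.hasDerivAt_arctan x).div_const 8).fun_add
      (hnum.fun_div hden (by positivity))).congr_deriv ?_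
    field_simp
    ring
  have hlim := tendsto_cube_sub_self_div_cocompact
  rw [cocompact_eq_atBot_atTop, tendsto_sup] at hlim
  rw [integral_of_hasDerivAt_of_tendsto hderiv integrable_sq_div_one_add_sq_cube
    (((tendsto_nhds_of_tendsto_nhdsWithin Real.tendsto_arctan_atBot).div_const 8).add hlim.1)
    (((tendsto_nhds_of_tendsto_nhdsWithin Real.tendsto_arctan_atTop).div_const 8).add hlim.2)]
  ring

theorem stmt2 :
    Integrable (fun x : ℝ => ((x : ℂ)) / ((((x : ℂ) - I) ^ 3) * (((x : ℂ) + I) ^ 2))) ∧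
      ∫ x : ℝ, ((x : ℂ)) / ((((x : ℂ) - I) ^ 3) * (((x : ℂ) + I) ^ 2)) = (π : ℂ) / 8 := by
  simp only [div_sub_I_cube_mul_add_I_sq]
  have hre : Integrable fun x : ℝ => ((x ^ 2 / (1 + x ^ 2) ^ 3 : ℝ) : ℂ) :=
    integrable_sq_div_one_add_sq_cube.ofReal
  have him : Integrable fun x : ℝ => ((x / (1 + x ^ 2) ^ 3 : ℝ) : ℂ) * I :=
    integrable_div_one_add_sq_cube.ofReal.mul_const I
  refine ⟨hre.add him, (integral_add hre him).trans ?_⟩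
  rw [integral_mul_const, integral_complex_ofReal, integral_complex_ofReal,
    integral_sq_div_one_add_sq_cube, integral_div_one_add_sq_cube]
  simp
end

section
/- The function x ↦ x/((x − i)^4 (x + i)^2) is integrable on ℝ and ∫_{-∞}^{+∞} x/((x − i)^4 (x + i)^2) dx = πi/8. -/
open Complex MeasureTheory Real

lemma ofReal_add_ne_zero_of_im_ne_zero {c : ℂ} (hc : c.im ≠ 0) (x : ℝ) : (x : ℂ) + c ≠ 0 := by
  intro h
  apply hc
  simpa using congrArg Complex.im h

lemma ofReal_sub_I_ne_zero (x : ℝ) : (x : ℂ) - I ≠ 0 := by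
  simpa [sub_eq_add_neg] using ofReal_add_ne_zero_of_im_ne_zero (c := -I) (by simp) x

lemma ofReal_add_I_ne_zero (x : ℝ) : (x : ℂ) + I ≠ 0 :=
  ofReal_add_ne_zero_of_im_ne_zero (by simp) x

lemma hasDerivAt_inv_ofReal_add {c : ℂ} {x : ℝ} (h : (x : ℂ) + c ≠ 0) :
    HasDerivAt (fun x : ℝ => ((x : ℂ) + c)⁻¹) (-1 / ((x : ℂ) + c) ^ 2) x :=
  (Complex.ofRealCLM.hasDerivAt.add_const c).fun_inv h

lemma tendsto_inv_ofReal_add_cocompact (c : ℂ) :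
    Filter.Tendsto (fun x : ℝ => ((x : ℂ) + c)⁻¹) (Filter.cocompact ℝ) (nhds 0) := by
  have h : Filter.Tendsto (fun x : ℝ => (x : ℂ) + c) (Filter.cocompact ℝ) (Filter.cocompact ℂ) :=
    ((Homeomorph.addRight c).isClosedEmbedding.comp
      Complex.isometry_ofReal.isClosedEmbedding).tendsto_cocompact
  exact (Filter.tendsto_inv₀_cobounded (α := ℂ)).comp
    (by simpa [Metric.cobounded_eq_cocompact] using h)

lemma integrable_div_sub_I_pow_four_mul_add_I_sq :
    Integrable (fun x : ℝ => (x : ℂ) / (((x : ℂ) - I) ^ 4 * ((x : ℂ) + I) ^ 2)) := by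
  refine integrable_inv_one_add_sq.mono' (Continuous.aestronglyMeasurable ?_) (.of_forall fun x => ?_)
  · refine Continuous.div (by fun_prop) (by fun_prop) fun x => ?_
    exact mul_ne_zero (pow_ne_zero _ (ofReal_sub_I_ne_zero x))
      (pow_ne_zero _ (ofReal_add_I_ne_zero x))
  · have hsub : ‖(x : ℂ) - I‖ ^ 2 = 1 + x ^ 2 := by
      rw [Complex.sq_norm, Complex.normSq_apply]; simp; ring
    have hadd : ‖(x : ℂ) + I‖ ^ 2 = 1 + x ^ 2 := by
      rw [Complex.sq_norm, Complex.normSq_apply]; simp; ring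
    rw [norm_div, norm_mul, norm_pow, norm_pow, hadd, show 4 = 2 * 2 from rfl, pow_mul, hsub,
      Complex.norm_real, Real.norm_eq_abs, inv_eq_one_div,
      div_le_div_iff₀ (by positivity) (by positivity), one_mul, mul_comm]
    have hx : |x| ≤ (1 + x ^ 2) ^ 2 := by
      nlinarith [sq_abs x, sq_nonneg (|x| - 1), sq_nonneg (x ^ 2)]
    nlinarith [sq_nonneg x]

/-- The rational part of a primitive of `z / ((z - I) ^ 4 * (z + I) ^ 2)`,
written in terms of `a = (z - I)⁻¹` and `b = (z + I)⁻¹`, plus its arctangent part `t`. -/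
noncomputable def primitiveOfInvs (a b t : ℂ) : ℂ :=
  I / 12 * a ^ 3 + I / 16 * a + I / 16 * b + I / 8 * t

lemma hasDerivAt_primitiveOfInvs (x : ℝ) :
    HasDerivAt
      (fun x : ℝ => primitiveOfInvs ((x : ℂ) + -I)⁻¹ ((x : ℂ) + I)⁻¹ (Real.arctan x : ℂ))
      ((x : ℂ) / (((x : ℂ) - I) ^ 4 * ((x : ℂ) + I) ^ 2)) x := by
  have hm := ofReal_sub_I_ne_zero x
  have hp := ofReal_add_I_ne_zero x
  have ha := hasDerivAt_inv_ofReal_add (c := -I) (x := x) (by rwa [← sub_eq_add_neg])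
  have hb := hasDerivAt_inv_ofReal_add hp
  have ht := (Real.hasDerivAt_arctan x).ofReal_comp
  have hfac : ((1 / (1 + x ^ 2) : ℝ) : ℂ) = 1 / (((x : ℂ) - I) * ((x : ℂ) + I)) := by
    push_cast
    congr 1
    linear_combination I_sq
  rw [hfac] at ht
  refine ((((ha.fun_pow 3).const_mul (I / 12)).add (ha.const_mul (I / 16))).add
    (hb.const_mul (I / 16)) |>.add (ht.const_mul (I / 8))).congr_deriv ?_
  simp only [← sub_eq_add_neg, Nat.add_one_sub_one]
  field_simp
  ring_nf
  simp only [show I ^ 3 = -I by simp, show I ^ 5 = I by rw [show I ^ 5 = I ^ 4 * I by ring]; simp,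
    I_sq, I_pow_four]
  ring

lemma tendsto_primitiveOfInvs {l : Filter ℝ} (hl : l ≤ Filter.cocompact ℝ) {t : ℝ}
    (ht : Filter.Tendsto Real.arctan l (nhds t)) :
    Filter.Tendsto
      (fun x : ℝ => primitiveOfInvs ((x : ℂ) + -I)⁻¹ ((x : ℂ) + I)⁻¹ (Real.arctan x : ℂ))
      l (nhds (I / 8 * t)) := by
  have ha := (tendsto_inv_ofReal_add_cocompact (-I)).mono_left hl
  have hb := (tendsto_inv_ofReal_add_cocompact I).mono_left hl
  have ht' := (Complex.continuous_ofReal.tendsto t).comp ht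
  simpa [primitiveOfInvs] using ((((ha.pow 3).const_mul (I / 12)).add (ha.const_mul (I / 16))).add
    (hb.const_mul (I / 16))).add (ht'.const_mul (I / 8))

theorem stmt3 :
    Integrable (fun x : ℝ => ((x : ℂ)) / ((((x : ℂ) - I) ^ 4) * (((x : ℂ) + I) ^ 2))) ∧
      ∫ x : ℝ, ((x : ℂ)) / ((((x : ℂ) - I) ^ 4) * (((x : ℂ) + I) ^ 2)) = (π : ℂ) * I / 8 := by
  refine ⟨integrable_div_sub_I_pow_four_mul_add_I_sq, ?_⟩
  rw [integral_of_hasDerivAt_of_tendsto hasDerivAt_primitiveOfInvs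
    integrable_div_sub_I_pow_four_mul_add_I_sq
    (tendsto_primitiveOfInvs atBot_le_cocompact
      (Real.tendsto_arctan_atBot.mono_right nhdsWithin_le_nhds))
    (tendsto_primitiveOfInvs atTop_le_cocompact
      (Real.tendsto_arctan_atTop.mono_right nhdsWithin_le_nhds))]
  push_cast
  ring
end

section
/- The function x ↦ (2 + 2ix − 6ix³ − 2i)/((x − i)^5 (x + i)^3) is integrable on ℝ and ∫_{-∞}^{+∞} (2 + 2ix − 6ix³ − 2i)/((x − i)^5 (x + i)^3) dx = (−11 + 15i)π/32. -/
open Complex MeasureTheory Real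

lemma norm_ofReal_add_I (x : ℝ) : ‖(x : ℂ) + I‖ = √(1 + x ^ 2) := by
  simpa [add_comm] using Complex.norm_add_mul_I x 1

lemma norm_ofReal_sub_I (x : ℝ) : ‖(x : ℂ) - I‖ = √(1 + x ^ 2) := by
  simpa [add_comm, sub_eq_add_neg] using Complex.norm_add_mul_I x (-1)

lemma one_add_ofReal_sq (x : ℝ) : (1 : ℂ) + (x : ℂ) ^ 2 = ((x : ℂ) - I) * ((x : ℂ) + I) := by
  linear_combination I_sq

lemma one_add_ofReal_sq_ne_zero (x : ℝ) : (1 : ℂ) + (x : ℂ) ^ 2 ≠ 0 := by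
  rw [one_add_ofReal_sq]
  exact mul_ne_zero (ofReal_sub_I_ne_zero x) (ofReal_add_I_ne_zero x)

lemma integrable_integrand : Integrable (fun x : ℝ =>
    (2 + 2 * I * (x : ℂ) - 6 * I * (x : ℂ) ^ 3 - 2 * I) /
      ((((x : ℂ) - I) ^ 5) * (((x : ℂ) + I) ^ 3))) := by
  refine (integrable_inv_one_add_sq.const_mul 12).mono' ?_ (.of_forall fun x => ?_)
  · refine (Continuous.div (by fun_prop) (by fun_prop) fun x => ?_).aestronglyMeasurable
    exact mul_ne_zero (pow_ne_zero _ (ofReal_sub_I_ne_zero x))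
      (pow_ne_zero _ (ofReal_add_I_ne_zero x))
  · rw [norm_div, norm_mul, norm_pow, norm_pow, norm_ofReal_sub_I, norm_ofReal_add_I]
    set r := √(1 + x ^ 2) with hr
    have hsq : r ^ 2 = 1 + x ^ 2 := Real.sq_sqrt (by positivity)
    have h1 : 1 ≤ r := Real.one_le_sqrt.2 (by nlinarith [sq_nonneg x])
    have hx : |x| ≤ r := Real.abs_le_sqrt (by linarith)
    have hnum : ‖2 + 2 * I * (x : ℂ) - 6 * I * (x : ℂ) ^ 3 - 2 * I‖ ≤ 12 * r ^ 3 := by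
      calc ‖2 + 2 * I * (x : ℂ) - 6 * I * (x : ℂ) ^ 3 - 2 * I‖
          ≤ ‖(2 : ℂ)‖ + ‖2 * I * (x : ℂ)‖ + ‖6 * I * (x : ℂ) ^ 3‖ + ‖2 * I‖ :=
            (norm_sub_le _ _).trans (by
              gcongr; exact (norm_sub_le _ _).trans (by gcongr; exact norm_add_le _ _))
        _ = 2 + 2 * |x| + 6 * |x| ^ 3 + 2 := by simp
        _ ≤ 2 * r ^ 3 + 2 * r ^ 3 + 6 * r ^ 3 + 2 * r ^ 3 := by
            have h3 : 1 ≤ r ^ 3 := one_le_pow₀ h1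
            have h4 : r ≤ r ^ 3 := le_self_pow₀ h1 (by norm_num)
            gcongr <;> linarith
        _ = 12 * r ^ 3 := by ring
    rw [← hsq, div_le_iff₀ (by positivity)]
    refine hnum.trans ?_
    have h6 : r ^ 3 ≤ r ^ 6 := pow_le_pow_right₀ h1 (by norm_num)
    have h0 : r ≠ 0 := by positivity
    calc 12 * r ^ 3 ≤ 12 * r ^ 6 := by gcongr
      _ = 12 * (r ^ 2)⁻¹ * (r ^ 5 * r ^ 3) := by field_simp

/-- The numerator of the rational part of an antiderivative of the integrand. -/
noncomputable def primitiveNum (z : ℂ) : ℂ :=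
  (-1 / 2 - I / 3) + (-53 / 32 + 49 / 32 * I) * z - I / 3 * z ^ 2
    + (-391 / 96 + 73 / 32 * I) * z ^ 3 + 3 / 2 * I * z ^ 4
    + (-121 / 96 + 55 / 32 * I) * z ^ 5 + (-11 / 32 + 15 / 32 * I) * z ^ 7

lemma hasDerivAt_primitiveNum (z : ℂ) : HasDerivAt primitiveNum
    ((-53 / 32 + 49 / 32 * I) - I / 3 * (2 * z)
      + (-391 / 96 + 73 / 32 * I) * (3 * z ^ 2) + 3 / 2 * I * (4 * z ^ 3)
      + (-121 / 96 + 55 / 32 * I) * (5 * z ^ 4) + (-11 / 32 + 15 / 32 * I) * (7 * z ^ 6)) z := by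
  have h (n : ℕ) (c : ℂ) := (hasDerivAt_pow n z).const_mul c
  refine ((((((((hasDerivAt_id z).const_mul (-53 / 32 + 49 / 32 * I)).const_add
    (-1 / 2 - I / 3)).fun_sub (h 2 (I / 3))).fun_add (h 3 (-391 / 96 + 73 / 32 * I))).fun_add
    (h 4 (3 / 2 * I))).fun_add (h 5 (-121 / 96 + 55 / 32 * I))).fun_add
    (h 7 (-11 / 32 + 15 / 32 * I))).congr_deriv ?_
  norm_num

/-- An antiderivative of the integrand. -/
noncomputable def primitive (x : ℝ) : ℂ :=
  primitiveNum x / (1 + (x : ℂ) ^ 2) ^ 4 + (-11 + 15 * I) / 32 * (Real.arctan x : ℂ)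

lemma hasDerivAt_primitive (x : ℝ) : HasDerivAt primitive
    ((2 + 2 * I * (x : ℂ) - 6 * I * (x : ℂ) ^ 3 - 2 * I) /
      ((((x : ℂ) - I) ^ 5) * (((x : ℂ) + I) ^ 3))) x := by
  have hne := one_add_ofReal_sq_ne_zero x
  have hden : HasDerivAt (fun z : ℂ => (1 + z ^ 2) ^ 4)
      (4 * (1 + (x : ℂ) ^ 2) ^ 3 * (2 * (x : ℂ))) x := by
    simpa using ((hasDerivAt_pow 2 (x : ℂ)).const_add 1).fun_pow 4
  have hrat := ((hasDerivAt_primitiveNum x).fun_div hden (pow_ne_zero 4 hne)).comp_ofReal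
  have harc := (Real.hasDerivAt_arctan x).ofReal_comp.const_mul ((-11 + 15 * I) / 32)
  refine (hrat.fun_add harc).congr_deriv ?_
  have hp := ofReal_add_I_ne_zero x
  have hm := ofReal_sub_I_ne_zero x
  have hrhs : (2 + 2 * I * (x : ℂ) - 6 * I * (x : ℂ) ^ 3 - 2 * I) /
      ((((x : ℂ) - I) ^ 5) * (((x : ℂ) + I) ^ 3)) =
      (2 + 2 * I * (x : ℂ) - 6 * I * (x : ℂ) ^ 3 - 2 * I) * (x + I) ^ 2 /
        (1 + (x : ℂ) ^ 2) ^ 5 := by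
    rw [one_add_ofReal_sq]
    field_simp
  rw [hrhs]
  unfold primitiveNum
  push_cast
  field_simp
  ring_nf
  simp only [I_sq, I_pow_three]
  ring_nf

lemma tendsto_primitiveNum_div {l : Filter ℝ} (hl : Filter.Tendsto (fun x : ℝ => x⁻¹) l (nhds 0))
    (h0 : ∀ᶠ x in l, x ≠ 0) :
    Filter.Tendsto (fun x : ℝ => primitiveNum x / (1 + (x : ℂ) ^ 2) ^ 4) l (nhds 0) := by
  let g : ℝ → ℂ := fun u => u * ((-1 / 2 - I / 3) * u ^ 7 + (-53 / 32 + 49 / 32 * I) * u ^ 6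
    - I / 3 * u ^ 5 + (-391 / 96 + 73 / 32 * I) * u ^ 4 + 3 / 2 * I * u ^ 3
    + (-121 / 96 + 55 / 32 * I) * u ^ 2 + (-11 / 32 + 15 / 32 * I)) / (1 + (u : ℂ) ^ 2) ^ 4
  have hg : Continuous g := by
    refine Continuous.div (by fun_prop) (by fun_prop) fun u => ?_
    exact pow_ne_zero _ (one_add_ofReal_sq_ne_zero u)
  have hlim : Filter.Tendsto (fun x : ℝ => g x⁻¹) l (nhds 0) := by
    have hg0 : g 0 = 0 := by simp [g]
    exact (hg0 ▸ hg.tendsto 0).comp hl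
  refine hlim.congr' ?_
  filter_upwards [h0] with x hx
  have hx' : (x : ℂ) ≠ 0 := ofReal_ne_zero.2 hx
  have hne := one_add_ofReal_sq_ne_zero x
  have hinv : (1 : ℂ) + ((x⁻¹ : ℝ) : ℂ) ^ 2 = (1 + (x : ℂ) ^ 2) / (x : ℂ) ^ 2 := by
    push_cast
    field_simp
    ring
  simp only [g, hinv, primitiveNum]
  push_cast
  field_simp

theorem stmt8 :
    Integrable (fun x : ℝ => (2 + 2 * I * (x : ℂ) - 6 * I * (x : ℂ) ^ 3 - 2 * I) / ((((x : ℂ) - I) ^ 5) * (((x : ℂ) + I) ^ 3))) ∧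
      ∫ x : ℝ, (2 + 2 * I * (x : ℂ) - 6 * I * (x : ℂ) ^ 3 - 2 * I) / ((((x : ℂ) - I) ^ 5) * (((x : ℂ) + I) ^ 3)) = (-11 + 15 * I) * (π : ℂ) / 32 := by
  refine ⟨integrable_integrand, ?_⟩
  have harc {l : Filter ℝ} {a : ℝ} (h : Filter.Tendsto Real.arctan l (nhds a)) :=
    ((continuous_ofReal.tendsto a).comp h).const_mul ((-11 + 15 * I) / 32)
  have htop := (tendsto_primitiveNum_div tendsto_inv_atTop_zero
    (Filter.eventually_ne_atTop 0)).add
    (harc (Real.tendsto_arctan_atTop.mono_right nhdsWithin_le_nhds))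
  have hbot := (tendsto_primitiveNum_div tendsto_inv_atBot_zero
    (Filter.eventually_ne_atBot 0)).add
    (harc (Real.tendsto_arctan_atBot.mono_right nhdsWithin_le_nhds))
  rw [integral_of_hasDerivAt_of_tendsto hasDerivAt_primitive integrable_integrand hbot htop]
  push_cast
  ring
end
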